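/- For every ε > 0 there exist constants c₁ = c₁(ε) > 0 and C₁ = C₁(ε) > 0 and σ₀ > 0 such that for all 0 < σ < σ₀, all real β ≥ 1, and every starting point x ∈ (−σ^{−β}, 0), the canonical Markov chain {X_t} with transition kernel K̂_σ and X_0 = x satisfies P[∃ t with 1 ≤ t ≤ e^{σ^{−β}} and X_t < −σ^{−β−ε}] ≤ C₁·e^{−c₁·σ^{−β−ε}}. -/

import Mathlib

open MeasureTheory Filter Set

/-- Gaussian density `φ_σ` with mean 0 and variance `σ²`. -/
noncomputable def gaussDensity (σ x : ℝ) : ℝ :=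
  (Real.sqrt (2 * Real.pi * σ ^ 2))⁻¹ * Real.exp (-(x ^ 2) / (2 * σ ^ 2))

/-- Density `f_σ` of the mixture `½ N(-1,σ²) + ½ N(1,σ²)`. -/
noncomputable def mixDensity (σ x : ℝ) : ℝ :=
  (1 / 2) * gaussDensity σ (x + 1) + (1 / 2) * gaussDensity σ (x - 1)

/-- The `N(0,σ²)` measure, defined via its density `φ_σ` w.r.t. Lebesgue measure. -/
noncomputable def gaussMeasure (σ : ℝ) : Measure ℝ :=
  volume.withDensity fun z => ENNReal.ofReal (gaussDensity σ z)

/-- The random-walk Metropolis kernel `K_σ(x, ·)` as a measure: the accepted-move part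
has density `min(1, f_σ(y)/f_σ(x))` w.r.t. the proposal `x + N(0,σ²)`, and the
remaining mass `1 − ∫ min(1, f_σ(x+z)/f_σ(x)) φ_σ(z) dz` stays at `x`. -/
noncomputable def rwmKernel (σ : ℝ) (x : ℝ) : Measure ℝ :=
  ((gaussMeasure σ).map (fun z => x + z)).withDensity
      (fun y => ENNReal.ofReal (min 1 (mixDensity σ y / mixDensity σ x)))
  + (ENNReal.ofReal
      (1 - ∫ z, min 1 (mixDensity σ (x + z) / mixDensity σ x) * gaussDensity σ z))
      • Measure.dirac x

/-- The restricted Metropolis–Hastings kernel `K̂_σ` on `(-∞,0)`: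
`K̂_σ(x,A) = K_σ(x, A ∩ (-∞,0)) + 1_A(x) K_σ(x,[0,∞))`. -/
noncomputable def rwmKernelHat (σ : ℝ) (x : ℝ) : Measure ℝ :=
  (rwmKernel σ x).restrict (Set.Iio 0) + (rwmKernel σ x (Set.Ici 0)) • Measure.dirac x

/-- `P` is the law on trajectory space (as produced by the Ionescu–Tulcea construction)
of the Markov chain with transition kernel `κ` started at `x`: a probability measure
with `X 0 = x` a.s. such that, conditionally on the first `n+1` coordinates,
`X (n+1)` has law `κ (X n)`. -/
def IsMarkovChainLaw {α : Type*} [MeasurableSpace α] (κ : α → Measure α) (x : α)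
    (P : Measure (ℕ → α)) : Prop :=
  IsProbabilityMeasure P ∧ P {ω | ω 0 = x} = 1 ∧
  ∀ (n : ℕ) (A : Set (ℕ → α)),
    MeasurableSet[MeasurableSpace.comap (fun ω (i : Fin (n + 1)) => ω i.1) inferInstance] A →
    ∀ B : Set α, MeasurableSet B →
      P (A ∩ {ω | ω (n + 1) ∈ B}) = ∫⁻ ω in A, κ (ω n) B ∂P

/-- Acceptance probability of the Metropolis move from `y` to `y'`. -/
noncomputable def acceptProb (σ y y' : ℝ) : ℝ := min 1 (mixDensity σ y' / mixDensity σ y)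

/-- Lyapunov function `e^{-y}` on the negative half-line, infinite elsewhere. -/
noncomputable def lyapunov (y : ℝ) : ENNReal :=
  if y < 0 then ENNReal.ofReal (Real.exp (-y)) else ⊤

theorem measurable_lyapunov : Measurable lyapunov :=
  Measurable.ite measurableSet_Iio (by fun_prop) measurable_const

theorem measurable_gaussDensity (σ : ℝ) : Measurable (gaussDensity σ) := by
  unfold gaussDensity
  fun_prop

theorem measurable_mixDensity (σ : ℝ) : Measurable (mixDensity σ) := by
  have := measurable_gaussDensity σ
  unfold mixDensity
  fun_prop

theorem Measurable.acceptProb {α : Type*} [MeasurableSpace α] (σ : ℝ) {f g : α → ℝ}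
    (hf : Measurable f) (hg : Measurable g) : Measurable fun a => acceptProb σ (f a) (g a) := by
  have := measurable_mixDensity σ
  unfold _root_.acceptProb
  fun_prop

theorem gaussDensity_pos {σ : ℝ} (hσ : 0 < σ) (x : ℝ) : 0 < gaussDensity σ x := by
  unfold gaussDensity
  positivity

theorem mixDensity_pos {σ : ℝ} (hσ : 0 < σ) (x : ℝ) : 0 < mixDensity σ x := by
  have := gaussDensity_pos hσ (x + 1)
  have := gaussDensity_pos hσ (x - 1)
  unfold mixDensity
  positivity

theorem acceptProb_nonneg {σ : ℝ} (hσ : 0 < σ) (y y' : ℝ) : 0 ≤ acceptProb σ y y' :=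
  le_min zero_le_one (div_pos (mixDensity_pos hσ _) (mixDensity_pos hσ _)).le

theorem acceptProb_le_one (σ y y' : ℝ) : acceptProb σ y y' ≤ 1 := min_le_left _ _

theorem gaussDensity_eq_gaussianPDFReal {σ : ℝ} (hσ : 0 < σ) (x : ℝ) :
    gaussDensity σ x = ProbabilityTheory.gaussianPDFReal 0 (σ.toNNReal ^ 2) x := by
  simp [gaussDensity, ProbabilityTheory.gaussianPDFReal, hσ.le]

theorem gaussMeasure_eq_gaussianReal {σ : ℝ} (hσ : 0 < σ) :
    gaussMeasure σ = ProbabilityTheory.gaussianReal 0 (σ.toNNReal ^ 2) := by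
  have h : σ.toNNReal ^ 2 ≠ 0 := pow_ne_zero _ (Real.toNNReal_pos.2 hσ).ne'
  rw [ProbabilityTheory.gaussianReal_of_var_ne_zero _ h, gaussMeasure]
  simp only [gaussDensity_eq_gaussianPDFReal hσ]
  rfl

theorem isProbabilityMeasure_gaussMeasure {σ : ℝ} (hσ : 0 < σ) :
    IsProbabilityMeasure (gaussMeasure σ) := by
  rw [gaussMeasure_eq_gaussianReal hσ]
  infer_instance

theorem lintegral_gaussMeasure_neg {σ : ℝ} (hσ : 0 < σ) {g : ℝ → ENNReal} (hg : Measurable g) :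
    ∫⁻ z, g (-z) ∂gaussMeasure σ = ∫⁻ z, g z ∂gaussMeasure σ := by
  have h : (gaussMeasure σ).map (fun z => -z) = gaussMeasure σ := by
    rw [gaussMeasure_eq_gaussianReal hσ, ProbabilityTheory.gaussianReal_map_neg, neg_zero]
  conv_rhs => rw [← h]
  rw [lintegral_map hg measurable_neg]

theorem ofReal_rejection_eq_lintegral {σ : ℝ} (hσ : 0 < σ) (y : ℝ) :
    ENNReal.ofReal (1 - ∫ z, min 1 (mixDensity σ (y + z) / mixDensity σ y) * gaussDensity σ z)
      = ∫⁻ z, ENNReal.ofReal (1 - acceptProb σ y (y + z)) ∂gaussMeasure σ := by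
  have := isProbabilityMeasure_gaussMeasure hσ
  have hm : Measurable fun z => acceptProb σ y (y + z) :=
    measurable_const.acceptProb σ (by fun_prop)
  have hi : Integrable (fun z => acceptProb σ y (y + z)) (gaussMeasure σ) := by
    refine Integrable.of_bound hm.aestronglyMeasurable 1 (Eventually.of_forall fun z => ?_)
    rw [Real.norm_of_nonneg (acceptProb_nonneg hσ _ _)]
    exact acceptProb_le_one _ _ _
  have h : ∫ z, min 1 (mixDensity σ (y + z) / mixDensity σ y) * gaussDensity σ z
      = ∫ z, acceptProb σ y (y + z) ∂gaussMeasure σ := by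
    rw [gaussMeasure, integral_withDensity_eq_integral_toReal_smul
      (measurable_gaussDensity σ).ennreal_ofReal (by simp)]
    refine integral_congr_ae (Eventually.of_forall fun z => ?_)
    simp [ENNReal.toReal_ofReal (gaussDensity_pos hσ z).le, acceptProb, mul_comm]
  have hi' : Integrable (fun z => 1 - acceptProb σ y (y + z)) (gaussMeasure σ) :=
    (integrable_const 1).sub hi
  rw [h, ← ofReal_integral_eq_lintegral_ofReal hi'
    (Eventually.of_forall fun z => sub_nonneg.2 (acceptProb_le_one _ _ _)),
    integral_sub (integrable_const 1) hi]
  simp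

/-- A function integrated against one step of the restricted chain, written as an integral over
the Gaussian proposal. -/
theorem lintegral_rwmKernelHat {σ : ℝ} (hσ : 0 < σ) (y : ℝ) {V : ℝ → ENNReal}
    (hV : Measurable V) :
    ∫⁻ u, V u ∂rwmKernelHat σ y = ∫⁻ z,
      (ENNReal.ofReal (acceptProb σ y (y + z)) * V (if y + z < 0 then y + z else y)
        + ENNReal.ofReal (1 - acceptProb σ y (y + z)) * V y) ∂gaussMeasure σ := by
  have hm : Measurable fun u => ENNReal.ofReal (acceptProb σ y u) :=
    (measurable_const.acceptProb σ measurable_id).ennreal_ofReal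
  have ht : Measurable fun z : ℝ => y + z := by fun_prop
  have hma : Measurable fun z => ENNReal.ofReal (acceptProb σ y (y + z)) := hm.comp ht
  have hmr : Measurable fun z => ENNReal.ofReal (1 - acceptProb σ y (y + z)) :=
    (measurable_const.sub (measurable_const.acceptProb σ ht)).ennreal_ofReal
  have hacc : ∀ W : ℝ → ENNReal, Measurable W →
      ∫⁻ u, W u ∂(((gaussMeasure σ).map (fun z => y + z)).withDensity
        (fun u => ENNReal.ofReal (min 1 (mixDensity σ u / mixDensity σ y))))
      = ∫⁻ z, ENNReal.ofReal (acceptProb σ y (y + z)) * W (y + z) ∂gaussMeasure σ := by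
    intro W hW
    change ∫⁻ u, W u ∂(((gaussMeasure σ).map (fun z => y + z)).withDensity
        (fun u => ENNReal.ofReal (acceptProb σ y u))) = _
    rw [lintegral_withDensity_eq_lintegral_mul _ hm hW, lintegral_map (hm.mul hW) ht]
    rfl
  have hK : ∀ W : ℝ → ENNReal, Measurable W → ∫⁻ u, W u ∂rwmKernel σ y =
      ∫⁻ z, (ENNReal.ofReal (acceptProb σ y (y + z)) * W (y + z)
        + ENNReal.ofReal (1 - acceptProb σ y (y + z)) * W y) ∂gaussMeasure σ := by
    intro W hW
    have hmul : Measurable fun z => ENNReal.ofReal (acceptProb σ y (y + z)) * W (y + z) :=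
      hma.mul (hW.comp ht)
    rw [rwmKernel, lintegral_add_measure, hacc W hW, lintegral_smul_measure, lintegral_dirac' _ hW,
      ofReal_rejection_eq_lintegral hσ, lintegral_add_left hmul,
      lintegral_mul_const _ hmr, smul_eq_mul]
  have h1 : Measurable ((Iio (0 : ℝ)).indicator V) := hV.indicator measurableSet_Iio
  have h2 : Measurable ((Ici (0 : ℝ)).indicator fun _ => V y) :=
    measurable_const.indicator measurableSet_Ici
  have h3 : rwmKernel σ y (Ici 0) * V y
      = ∫⁻ u, (Ici (0 : ℝ)).indicator (fun _ => V y) u ∂rwmKernel σ y := by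
    rw [lintegral_indicator_const measurableSet_Ici, mul_comm]
  rw [rwmKernelHat, lintegral_add_measure, lintegral_smul_measure, lintegral_dirac' _ hV,
    smul_eq_mul, h3, ← lintegral_indicator measurableSet_Iio, ← lintegral_add_left h1,
    hK (fun u => (Iio (0 : ℝ)).indicator V u + (Ici (0 : ℝ)).indicator (fun _ => V y) u)
      (h1.add h2)]
  refine lintegral_congr fun z => ?_
  congr 2
  · by_cases h : y + z < 0
    · simp [h, not_le.2 h]
    · simp [h, not_lt.1 h]
  · by_cases h : y < 0
    · simp [h, not_le.2 h]
    · simp [h, not_lt.1 h]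

theorem measurable_rwmKernelHat {σ : ℝ} (hσ : 0 < σ) : Measurable (rwmKernelHat σ) := by
  refine Measure.measurable_of_measurable_coe _ fun B hB => ?_
  have := isProbabilityMeasure_gaussMeasure hσ
  have hV : Measurable (B.indicator (1 : ℝ → ENNReal)) := measurable_one.indicator hB
  have h : (fun y => rwmKernelHat σ y B) = fun y => ∫⁻ z,
      (ENNReal.ofReal (acceptProb σ y (y + z))
          * B.indicator (1 : ℝ → ENNReal) (if y + z < 0 then y + z else y)
        + ENNReal.ofReal (1 - acceptProb σ y (y + z)) * B.indicator (1 : ℝ → ENNReal) y)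
        ∂gaussMeasure σ :=
    funext fun y => by rw [← lintegral_indicator_one hB, lintegral_rwmKernelHat hσ y hV]
  rw [h]
  have ha : Measurable fun p : ℝ × ℝ => acceptProb σ p.1 (p.1 + p.2) :=
    measurable_fst.acceptProb σ (measurable_fst.add measurable_snd)
  have hs : Measurable fun p : ℝ × ℝ => if p.1 + p.2 < 0 then p.1 + p.2 else p.1 :=
    Measurable.ite (measurableSet_lt (by fun_prop) measurable_const) (by fun_prop) (by fun_prop)
  refine Measurable.lintegral_prod_right (f := fun y z => _) ?_
  exact ((ha.ennreal_ofReal.mul (hV.comp hs)).add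
    ((measurable_const.sub ha).ennreal_ofReal.mul (hV.comp measurable_fst)))

theorem gaussDensity_le_exp_mul {σ : ℝ} (hσ : 0 < σ) {u v k : ℝ}
    (h : 2 * σ ^ 2 * k + v ^ 2 ≤ u ^ 2) :
    gaussDensity σ u ≤ Real.exp (-k) * gaussDensity σ v := by
  unfold gaussDensity
  rw [mul_left_comm, ← Real.exp_add]
  refine mul_le_mul_of_nonneg_left (Real.exp_le_exp.2 ?_) (by positivity)
  rw [← sub_nonneg]
  have : -k + -v ^ 2 / (2 * σ ^ 2) - -u ^ 2 / (2 * σ ^ 2)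
      = (u ^ 2 - (2 * σ ^ 2 * k + v ^ 2)) / (2 * σ ^ 2) := by
    field_simp
    ring
  rw [this]
  exact div_nonneg (by linarith) (by positivity)

theorem acceptProb_eq_one {σ : ℝ} (hσ : 0 < σ) {y u : ℝ} (hyu : y ≤ u) (hu : u ≤ -1) :
    acceptProb σ y u = 1 := by
  have h1 := gaussDensity_le_exp_mul hσ (u := y + 1) (v := u + 1) (k := 0) (by nlinarith)
  have h2 := gaussDensity_le_exp_mul hσ (u := y - 1) (v := u - 1) (k := 0) (by nlinarith)
  rw [neg_zero, Real.exp_zero, one_mul] at h1 h2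
  refine min_eq_left ((one_le_div (mixDensity_pos hσ y)).2 ?_)
  unfold mixDensity
  linarith

theorem acceptProb_sub_le_of_le {σ : ℝ} (hσ : 0 < σ) (hσ' : σ ≤ 1 / 2) {y s : ℝ}
    (hy : y ≤ -2) (hs : 0 ≤ s) :
    acceptProb σ y (y - s) ≤ Real.exp (-(2 * s)) := by
  have hq : σ ^ 2 ≤ 1 / 4 := by nlinarith
  have hqs : σ ^ 2 * s ≤ 1 / 4 * s := mul_le_mul_of_nonneg_right hq hs
  have h1 := gaussDensity_le_exp_mul hσ (u := y - s + 1) (v := y + 1) (k := 2 * s) (by nlinarith)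
  have h2 := gaussDensity_le_exp_mul hσ (u := y - s - 1) (v := y - 1) (k := 2 * s) (by nlinarith)
  refine (min_le_right _ _).trans ((div_le_iff₀ (mixDensity_pos hσ y)).2 ?_)
  unfold mixDensity
  linarith

theorem acceptProb_sub_le_of_three_le {σ : ℝ} (hσ : 0 < σ) (hσ' : σ ≤ 1 / 2) {y s : ℝ}
    (hy0 : y < 0) (hs : 3 ≤ s) :
    acceptProb σ y (y - s) ≤ 2 * Real.exp (-s) := by
  have hq : σ ^ 2 ≤ 1 / 4 := by nlinarith
  have hqs : σ ^ 2 * s ≤ 1 / 4 * s := mul_le_mul_of_nonneg_right hq (by linarith)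
  have h1 := gaussDensity_le_exp_mul hσ (u := y - s + 1) (v := y + 1) (k := s) (by nlinarith)
  have h2 := gaussDensity_le_exp_mul hσ (u := y - s - 1) (v := y + 1) (k := s) (by nlinarith)
  refine (min_le_right _ _).trans ((div_le_iff₀ (mixDensity_pos hσ y)).2 ?_)
  have h3 := mul_pos (Real.exp_pos (-s)) (gaussDensity_pos hσ (y - 1))
  unfold mixDensity
  nlinarith

/-- The gain of a leftward proposal is compensated by the loss of the opposite one, up to a
constant. -/
theorem exp_gain_le {σ : ℝ} (hσ : 0 < σ) (hσ' : σ ≤ 1 / 2) {y s : ℝ} (hy : y < 0) (hs : 0 ≤ s) :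
    acceptProb σ y (y - s) * (Real.exp (-(y - s)) - Real.exp (-y))
      + acceptProb σ y (y + s)
        * (Real.exp (-(if y + s < 0 then y + s else y)) - Real.exp (-y)) ≤ Real.exp 5 := by
  have hleft : 0 ≤ Real.exp (-(y - s)) - Real.exp (-y) :=
    sub_nonneg.2 (Real.exp_le_exp.2 (by linarith))
  have hright : acceptProb σ y (y + s)
      * (Real.exp (-(if y + s < 0 then y + s else y)) - Real.exp (-y)) ≤ 0 := by
    refine mul_nonpos_of_nonneg_of_nonpos (acceptProb_nonneg hσ _ _)
      (sub_nonpos.2 (Real.exp_le_exp.2 ?_))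
    split_ifs <;> linarith
  rcases le_or_gt y (-2) with hy2 | hy2
  · have ha := mul_le_mul_of_nonneg_right (acceptProb_sub_le_of_le hσ hσ' hy2 hs) hleft
    rw [mul_sub, mul_sub (Real.exp _), ← Real.exp_add, ← Real.exp_add] at ha
    rcases le_or_gt (y + s) (-1) with hys | hys
    · rw [acceptProb_eq_one hσ (by linarith) hys, if_pos (by linarith), one_mul]
      have e1 : -(2 * s) + -(y - s) = -(y + s) := by ring
      have e2 : Real.exp (-(y + s)) = Real.exp (-y) * Real.exp (-s) := by
        rw [← Real.exp_add]; ring_nf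
      have e3 : Real.exp (-(2 * s) + -y) = Real.exp (-y) * Real.exp (-s) ^ 2 := by
        rw [← Real.exp_nat_mul, ← Real.exp_add]; push_cast; ring_nf
      rw [e1, ← mul_sub, e2, e3] at ha
      rw [e2]
      have := mul_nonneg (Real.exp_pos (-y)).le (sq_nonneg (1 - Real.exp (-s)))
      have := Real.exp_pos 5
      nlinarith
    · have h5 : Real.exp (-(2 * s) + -(y - s)) ≤ Real.exp 5 :=
        Real.exp_le_exp.2 (by linarith)
      have := Real.exp_pos (-(2 * s) + -y)
      rw [mul_sub]
      linarith
  · suffices h : acceptProb σ y (y - s) * Real.exp (-(y - s)) ≤ Real.exp 5 by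
      have := mul_nonneg (acceptProb_nonneg hσ y (y - s)) (Real.exp_pos (-y)).le
      rw [mul_sub]
      linarith
    rcases le_or_gt s 3 with hs3 | hs3
    · calc _ ≤ 1 * Real.exp (-(y - s)) :=
            mul_le_mul_of_nonneg_right (acceptProb_le_one _ _ _) (Real.exp_pos _).le
        _ ≤ _ := by rw [one_mul]; exact Real.exp_le_exp.2 (by linarith)
    · have h2 : (2 : ℝ) ≤ Real.exp 3 := by linarith [Real.add_one_le_exp (3 : ℝ)]
      calc _ ≤ (2 * Real.exp (-s)) * Real.exp (-(y - s)) :=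
            mul_le_mul_of_nonneg_right (acceptProb_sub_le_of_three_le hσ hσ' hy hs3.le)
              (Real.exp_pos _).le
        _ = 2 * Real.exp (-y) := by rw [mul_assoc, ← Real.exp_add]; ring_nf
        _ ≤ Real.exp 3 * Real.exp 2 :=
            mul_le_mul h2 (Real.exp_le_exp.2 (by linarith)) (Real.exp_pos _).le (Real.exp_pos _).le
        _ = Real.exp 5 := by rw [← Real.exp_add]; norm_num

/-- Additive drift condition for the restricted chain. -/
theorem lintegral_lyapunov_le {σ : ℝ} (hσ : 0 < σ) (hσ' : σ ≤ 1 / 2) (y : ℝ) :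
    ∫⁻ u, lyapunov u ∂rwmKernelHat σ y ≤ lyapunov y + ENNReal.ofReal (Real.exp 5) := by
  by_cases hy : y < 0
  swap
  · simp [lyapunov, hy]
  have := isProbabilityMeasure_gaussMeasure hσ
  set W : ℝ → ℝ := fun z => acceptProb σ y (y + z) * Real.exp (-(if y + z < 0 then y + z else y))
    + (1 - acceptProb σ y (y + z)) * Real.exp (-y) with hW
  have hW0 : ∀ z, 0 ≤ W z := fun z => add_nonneg
    (mul_nonneg (acceptProb_nonneg hσ _ _) (Real.exp_pos _).le)
    (mul_nonneg (sub_nonneg.2 (acceptProb_le_one _ _ _)) (Real.exp_pos _).le)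
  have ha : Measurable fun z => acceptProb σ y (y + z) :=
    measurable_const.acceptProb σ (measurable_const.add measurable_id)
  have hs : Measurable fun z : ℝ => if y + z < 0 then y + z else y :=
    Measurable.ite (measurableSet_lt (by fun_prop) measurable_const) (by fun_prop) (by fun_prop)
  have hWm : Measurable W := by fun_prop
  have hstep : ∫⁻ u, lyapunov u ∂rwmKernelHat σ y = ∫⁻ z, ENNReal.ofReal (W z) ∂gaussMeasure σ := by
    rw [lintegral_rwmKernelHat hσ y measurable_lyapunov]
    refine lintegral_congr fun z => ?_
    have hneg : (if y + z < 0 then y + z else y) < 0 := by split_ifs <;> assumption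
    rw [lyapunov, lyapunov, if_pos hneg, if_pos hy, hW, ENNReal.ofReal_add
      (mul_nonneg (acceptProb_nonneg hσ _ _) (Real.exp_pos _).le)
      (mul_nonneg (sub_nonneg.2 (acceptProb_le_one _ _ _)) (Real.exp_pos _).le),
      ENNReal.ofReal_mul (acceptProb_nonneg hσ _ _),
      ENNReal.ofReal_mul (sub_nonneg.2 (acceptProb_le_one _ _ _))]
  have hpair_nonneg : ∀ s, 0 ≤ s → W s + W (-s) ≤ 2 * Real.exp (-y) + Real.exp 5 := by
    intro s hs
    have h := exp_gain_le hσ hσ' hy hs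
    have hneg : y - s < 0 := by linarith
    simp only [hW, ← sub_eq_add_neg, if_pos hneg]
    linarith
  have hpair : ∀ z, W z + W (-z) ≤ 2 * Real.exp (-y) + Real.exp 5 := by
    intro z
    rcases le_total 0 z with hz | hz
    · exact hpair_nonneg z hz
    · simpa [add_comm] using hpair_nonneg (-z) (by linarith)
  have hdouble : 2 * ∫⁻ z, ENNReal.ofReal (W z) ∂gaussMeasure σ
      ≤ 2 * (ENNReal.ofReal (Real.exp (-y)) + ENNReal.ofReal (Real.exp 5)) := by
    calc 2 * ∫⁻ z, ENNReal.ofReal (W z) ∂gaussMeasure σ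
        = ∫⁻ z, ENNReal.ofReal (W z) ∂gaussMeasure σ
          + ∫⁻ z, ENNReal.ofReal (W (-z)) ∂gaussMeasure σ := by
          rw [lintegral_gaussMeasure_neg hσ hWm.ennreal_ofReal, two_mul]
      _ = ∫⁻ z, ENNReal.ofReal (W z + W (-z)) ∂gaussMeasure σ := by
          rw [← lintegral_add_left hWm.ennreal_ofReal]
          exact lintegral_congr fun z => (ENNReal.ofReal_add (hW0 _) (hW0 _)).symm
      _ ≤ ∫⁻ _, ENNReal.ofReal (2 * Real.exp (-y) + 2 * Real.exp 5) ∂gaussMeasure σ :=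
          lintegral_mono fun z => ENNReal.ofReal_le_ofReal
            ((hpair z).trans (by linarith [Real.exp_pos 5]))
      _ = _ := by
          rw [lintegral_const, measure_univ, mul_one, ← mul_add,
            ENNReal.ofReal_mul zero_le_two,
            ENNReal.ofReal_add (Real.exp_pos _).le (Real.exp_pos _).le]
          simp
  rw [hstep, lyapunov, if_pos hy]
  exact (ENNReal.mul_le_mul_iff_right two_ne_zero ENNReal.ofNat_ne_top).1 hdouble

/-- An additive drift condition gives linear growth of the expectation along a Markov chain. -/
theorem IsMarkovChainLaw.lintegral_le {α : Type*} [MeasurableSpace α] [MeasurableSingletonClass α]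
    {κ : α → Measure α} {x : α} {P : Measure (ℕ → α)} (hP : IsMarkovChainLaw κ x P)
    (hκ : Measurable κ) {V : α → ENNReal} (hV : Measurable V) {b : ENNReal}
    (hdrift : ∀ y, ∫⁻ u, V u ∂κ y ≤ V y + b) (n : ℕ) :
    ∫⁻ ω, V (ω n) ∂P ≤ V x + n * b := by
  obtain ⟨hprob, h0, hstep⟩ := hP
  induction n with
  | zero =>
    have hae : ∀ᵐ ω ∂P, ω 0 = x :=
      (prob_compl_eq_zero_iff (s := (fun ω : ℕ → α => ω 0) ⁻¹' {x})
        (measurable_pi_apply 0 (measurableSet_singleton x))).2 h0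
    have h : (fun ω : ℕ → α => V (ω 0)) =ᵐ[P] fun _ => V x := by
      filter_upwards [hae] with ω hω
      rw [hω]
    simp [lintegral_congr_ae h]
  | succ n ih =>
    have hmap : P.map (fun ω => ω (n + 1)) = (P.map (fun ω => ω n)).bind κ := by
      ext B hB
      have := hstep n univ MeasurableSet.univ B hB
      rw [univ_inter, setLIntegral_univ] at this
      rw [Measure.map_apply (measurable_pi_apply _) hB, Measure.bind_apply hB hκ.aemeasurable,
        lintegral_map (f := fun y => κ y B) ((Measure.measurable_coe hB).comp hκ)
          (measurable_pi_apply n)]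
      exact this
    calc ∫⁻ ω, V (ω (n + 1)) ∂P = ∫⁻ u, V u ∂P.map (fun ω => ω (n + 1)) :=
          (lintegral_map hV (measurable_pi_apply _)).symm
      _ = ∫⁻ y, ∫⁻ u, V u ∂κ y ∂P.map (fun ω => ω n) := by
          rw [hmap, Measure.lintegral_bind hκ.aemeasurable hV.aemeasurable]
      _ ≤ ∫⁻ y, (V y + b) ∂P.map (fun ω => ω n) := lintegral_mono hdrift
      _ = ∫⁻ ω, V (ω n) ∂P + b := by
          rw [lintegral_map (hV.add_const b) (measurable_pi_apply _),
            lintegral_add_right _ measurable_const]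
          simp
      _ ≤ V x + n * b + b := by gcongr
      _ = V x + (n + 1 : ℕ) * b := by push_cast; ring

/-- Tail bound for the restricted chain at a fixed time. -/
theorem measure_lt_neg_le {σ : ℝ} (hσ : 0 < σ) (hσ' : σ ≤ 1 / 2) {x : ℝ} (hx : x < 0)
    {P : Measure (ℕ → ℝ)} (hP : IsMarkovChainLaw (rwmKernelHat σ) x P) (L : ℝ) (t : ℕ) :
    P {ω | ω t < -L}
      ≤ ENNReal.ofReal (Real.exp (-L) * (Real.exp (-x) + t * Real.exp 5)) := by
  have hE := hP.lintegral_le (measurable_rwmKernelHat hσ) measurable_lyapunov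
    (lintegral_lyapunov_le hσ hσ') t
  have hsub : {ω : ℕ → ℝ | ω t < -L}
      ⊆ {ω | ENNReal.ofReal (Real.exp L) ≤ lyapunov (ω t)} := by
    intro ω hω
    simp only [mem_ofPred_eq, lyapunov] at hω ⊢
    split_ifs
    · exact ENNReal.ofReal_le_ofReal (Real.exp_le_exp.2 (by linarith))
    · exact le_top
  have hmk := mul_meas_ge_le_lintegral (μ := P)
    (measurable_lyapunov.comp (measurable_pi_apply t)) (ENNReal.ofReal (Real.exp L))
  have hx' : lyapunov x = ENNReal.ofReal (Real.exp (-x)) := if_pos hx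
  calc P {ω | ω t < -L} ≤ P {ω | ENNReal.ofReal (Real.exp L) ≤ lyapunov (ω t)} :=
        measure_mono hsub
    _ = ENNReal.ofReal (Real.exp (-L)) * (ENNReal.ofReal (Real.exp L)
          * P {ω | ENNReal.ofReal (Real.exp L) ≤ lyapunov (ω t)}) := by
        rw [← mul_assoc, ← ENNReal.ofReal_mul (Real.exp_pos _).le, ← Real.exp_add]
        simp
    _ ≤ ENNReal.ofReal (Real.exp (-L)) * (lyapunov x + t * ENNReal.ofReal (Real.exp 5)) := by
        gcongr
        exact hmk.trans hE
    _ = _ := by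
        rw [hx', ENNReal.ofReal_mul (Real.exp_pos _).le, ENNReal.ofReal_add (by positivity)
          (by positivity), ENNReal.ofReal_mul (by positivity), ENNReal.ofReal_natCast]

/-- Excursions of the chain with kernel `K̂_σ` far into the left tail are very unlikely:
started at `x ∈ (-σ^{-β}, 0)`, the chain goes below `-σ^{-β-ε}` within the first
`e^{σ^{-β}}` steps with probability at most `C₁ e^{-c₁ σ^{-β-ε}}`, uniformly in `β ≥ 1`. -/
theorem stmt15 (ε : ℝ) (hε : 0 < ε) :
    ∃ c C : ℝ, 0 < c ∧ 0 < C ∧ ∃ σ₀ : ℝ, 0 < σ₀ ∧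
      ∀ σ : ℝ, 0 < σ → σ < σ₀ →
        ∀ β : ℝ, 1 ≤ β →
          ∀ x ∈ Set.Ioo (-(σ ^ (-β))) (0 : ℝ), ∀ P : Measure (ℕ → ℝ),
            IsMarkovChainLaw (rwmKernelHat σ) x P →
              (P {ω | ∃ t : ℕ, 1 ≤ t ∧ (t : ℝ) ≤ Real.exp (σ ^ (-β)) ∧
                  ω t < -(σ ^ (-β - ε))}).toReal
                ≤ C * Real.exp (-c * σ ^ (-β - ε)) := by
  refine ⟨1 / 2, 1 + Real.exp 5, by norm_num, by positivity,
    min (1 / 2) ((4 : ℝ) ^ (-ε⁻¹)), by positivity, ?_⟩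
  intro σ hσ hσ₀ β _ x hx P hP
  have hhalf : σ ≤ 1 / 2 := (hσ₀.trans_le (min_le_left _ _)).le
  have hprob := hP.1
  set M := σ ^ (-β) with hM
  set L := σ ^ (-β - ε) with hL
  have hLM : 4 * M ≤ L := by
    have h4 : (4 : ℝ) ≤ σ ^ (-ε) := by
      have h := Real.rpow_le_rpow_of_nonpos hσ (hσ₀.trans_le (min_le_right _ _)).le
        (neg_nonpos.2 hε.le)
      rwa [← Real.rpow_mul (by norm_num), neg_mul_neg, inv_mul_cancel₀ hε.ne',
        Real.rpow_one] at h
    have hsplit : L = M * σ ^ (-ε) := by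
      rw [hL, hM, ← Real.rpow_add hσ, sub_eq_add_neg]
    have : 0 < M := Real.rpow_pos_of_pos hσ _
    rw [hsplit]
    nlinarith
  set N := ⌊Real.exp M⌋₊
  have hN : (N : ℝ) ≤ Real.exp M := Nat.floor_le (Real.exp_pos M).le
  have hM1 : 1 ≤ Real.exp M := Real.one_le_exp (Real.rpow_pos_of_pos hσ _).le
  have hsub : {ω : ℕ → ℝ | ∃ t : ℕ, 1 ≤ t ∧ (t : ℝ) ≤ Real.exp M ∧ ω t < -L}
      ⊆ ⋃ t ∈ Finset.Icc 1 N, {ω | ω t < -L} := by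
    rintro ω ⟨t, h1, ht, hω⟩
    exact mem_iUnion₂.2 ⟨t, Finset.mem_Icc.2 ⟨h1, Nat.le_floor ht⟩, hω⟩
  have hbound : ∀ t ∈ Finset.Icc 1 N, P {ω : ℕ → ℝ | ω t < -L}
      ≤ ENNReal.ofReal (Real.exp (-L) * ((1 + Real.exp 5) * Real.exp M)) := by
    intro t ht
    refine (measure_lt_neg_le hσ hhalf hx.2 hP L t).trans (ENNReal.ofReal_le_ofReal ?_)
    have h1 : Real.exp (-x) ≤ Real.exp M := Real.exp_le_exp.2 (by linarith [hx.1])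
    have h2 : (t : ℝ) ≤ Real.exp M :=
      (Nat.cast_le.2 (Finset.mem_Icc.1 ht).2).trans hN
    refine mul_le_mul_of_nonneg_left ?_ (Real.exp_pos _).le
    nlinarith [Real.exp_pos 5]
  refine ENNReal.toReal_le_of_le_ofReal (by positivity) ?_
  calc P {ω : ℕ → ℝ | ∃ t : ℕ, 1 ≤ t ∧ (t : ℝ) ≤ Real.exp M ∧ ω t < -L}
      ≤ ∑ t ∈ Finset.Icc 1 N, P {ω : ℕ → ℝ | ω t < -L} :=
        (measure_mono hsub).trans (measure_biUnion_finset_le _ _)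
    _ ≤ N * ENNReal.ofReal (Real.exp (-L) * ((1 + Real.exp 5) * Real.exp M)) := by
        refine (Finset.sum_le_sum hbound).trans_eq ?_
        simp
    _ = ENNReal.ofReal (N * (Real.exp (-L) * ((1 + Real.exp 5) * Real.exp M))) := by
        rw [ENNReal.ofReal_mul (Nat.cast_nonneg N), ENNReal.ofReal_natCast]
    _ ≤ ENNReal.ofReal ((1 + Real.exp 5) * Real.exp (-(1 / 2) * L)) := by
        refine ENNReal.ofReal_le_ofReal ?_
        calc N * (Real.exp (-L) * ((1 + Real.exp 5) * Real.exp M))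
            ≤ Real.exp M * (Real.exp (-L) * ((1 + Real.exp 5) * Real.exp M)) :=
              mul_le_mul_of_nonneg_right hN (by positivity)
          _ = (1 + Real.exp 5) * Real.exp (M + -L + M) := by
              rw [Real.exp_add, Real.exp_add]
              ring
          _ ≤ _ := mul_le_mul_of_nonneg_left (Real.exp_le_exp.2 (by linarith)) (by positivity)
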